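/- Let d ≥ 4 and e ≥ d + 1 be integers and set h(x) = d·x − (d−1)(d−2)/2 + 1. Then every integer s with 1 ≤ s ≤ h(e−1) − 1 belongs to the union {h(e−2) − t : t ∈ ℤ, ⌈h(e−3)/3⌉ ≤ t ≤ h(e−2) − 1} ∪ {h(e−1) − t : t ∈ ℤ, 1 ≤ t ≤ h(e−1) − ⌈h(e)/3⌉}. (That is, the surpluses reachable by Gorenstein links of type 1 together with those reachable by links of type 2 cover all surpluses from 1 to h(e−1) − 1.) -/

import Mathlib

/-- The first difference of the Hilbert function of a degree-`d` surface in `ℙ³`: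
`h(x) = d*x - (d-1)(d-2)/2 + 1` (the division is exact). -/
def hS (d x : ℤ) : ℤ := d * x - (d - 1) * (d - 2) / 2 + 1

theorem three_mul_ceil_div_three_le (a : ℤ) : 3 * ⌈(a : ℚ) / 3⌉ ≤ a + 2 := by
  have h := Int.ceil_lt_add_one ((a : ℚ) / 3)
  have h' : 3 * ⌈(a : ℚ) / 3⌉ < a + 3 := (Int.cast_lt (R := ℚ)).mp (by push_cast; linarith)
  omega

theorem hS_add (d x k : ℤ) : hS d (x + k) = hS d x + d * k := by
  unfold hS
  ring

theorem add_one_le_hS {d x : ℤ} (hd : 4 ≤ d) (hx : d - 1 ≤ x) : d + 1 ≤ hS d x := by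
  have hdiv : (d - 1) * (d - 2) / 2 * 2 ≤ (d - 1) * (d - 2) := Int.ediv_mul_le _ two_ne_zero
  unfold hS
  nlinarith

/-- For integers `d ≥ 4` and `e ≥ d+1`, every surplus `s` with `1 ≤ s ≤ h(e-1) - 1` is
reachable either by a link of type 1 (as `h(e-2) - t` with `⌈h(e-3)/3⌉ ≤ t ≤ h(e-2)-1`)
or by a link of type 2 (as `h(e-1) - t` with `1 ≤ t ≤ h(e-1) - ⌈h(e)/3⌉`). -/
theorem surpluses_covered (d e : ℤ) (hd : 4 ≤ d) (he : d + 1 ≤ e) :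
    ∀ s : ℤ, 1 ≤ s → s ≤ hS d (e - 1) - 1 →
      (∃ t : ℤ, ⌈(hS d (e - 3) : ℚ) / 3⌉ ≤ t ∧ t ≤ hS d (e - 2) - 1 ∧ s = hS d (e - 2) - t) ∨
      (∃ t : ℤ, 1 ≤ t ∧ t ≤ hS d (e - 1) - ⌈(hS d e : ℚ) / 3⌉ ∧ s = hS d (e - 1) - t) := by
  intro s hs1 hs2
  have hH : d + 1 ≤ hS d (e - 2) := add_one_le_hS hd (by linarith)
  have h0 : hS d e = hS d (e - 2) + d * 2 := by rw [← hS_add]; congr 1; ring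
  have h3 : hS d (e - 3) = hS d (e - 2) + d * (-1) := by rw [← hS_add]; congr 1; ring
  have hc3 := three_mul_ceil_div_three_le (hS d (e - 3))
  have hc0 := three_mul_ceil_div_three_le (hS d e)
  by_cases hs : s ≤ hS d (e - 2) - ⌈(hS d (e - 3) : ℚ) / 3⌉
  · exact Or.inl ⟨hS d (e - 2) - s, by omega, by omega, by ring⟩
  · exact Or.inr ⟨hS d (e - 1) - s, by omega, by omega, by ring⟩
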